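/- Let D ⊂ ℝ^d be compact with D = closure(D°) and μ_d(∂D) = 0, and {f₁,…,f_k} injective contractions whose attractor E has μ_d(E) = 0. Suppose Y ⊆ D satisfies: (1) Y = closure(Y°) and μ_d(∂Y) = 0; (2) Y, f₁(Y), …, f_k(Y) are subsets of D, mutually disjoint in measure; (3) Y, f₁(D \ Φ(Y)), …, f_k(D \ Φ(Y)) are subsets of D, mutually disjoint in measure. Then D admits a dissection with respect to {f₁,…,f_k}. -/

import Mathlib

open MeasureTheory

/-- `Φ(X) = ⋃ i, fᵢ(X)`. -/
def PhiMap {d k : ℕ} (f : Fin k → EuclideanSpace ℝ (Fin d) → EuclideanSpace ℝ (Fin d)) :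
    Set (EuclideanSpace ℝ (Fin d)) → Set (EuclideanSpace ℝ (Fin d)) :=
  fun X => ⋃ i, f i '' X

open Set Metric Filter Topology Function Module
open scoped NNReal ENNReal

section Degree

variable {E : Type*} [NormedAddCommGroup E] [InnerProductSpace ℝ E] [FiniteDimensional ℝ E]

theorem det_one_add_pos_of_norm_lt_one {A : E →L[ℝ] E} (hA : ‖A‖ < 1) :
    0 < (1 + A).det := by
  have hne : ∀ s ∈ Icc (0 : ℝ) 1, (1 + s • A).det ≠ 0 := by
    intro s hs
    have hlt : ‖-(s • A)‖ < 1 := by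
      rw [norm_neg, norm_smul, Real.norm_of_nonneg hs.1]
      nlinarith [norm_nonneg A, hs.2]
    have h := isUnit_one_sub_of_norm_lt_one hlt
    rw [sub_neg_eq_add] at h
    have := (h.map (ContinuousLinearMap.toLinearMapRingHom (R₁ := ℝ) (M₁ := E))).map
      (LinearMap.det (A := ℝ) (M := E))
    exact this.ne_zero
  have hcont : Continuous fun s : ℝ => (1 + s • A).det :=
    ContinuousLinearMap.continuous_det.comp (by fun_prop)
  by_contra! hle
  have h0 : (1 + (0 : ℝ) • A).det = 1 := by simp [ContinuousLinearMap.det]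
  have : (0 : ℝ) ∈ Icc ((1 + (1 : ℝ) • A).det) ((1 + (0 : ℝ) • A).det) := by
    rw [h0, one_smul]
    exact ⟨hle, zero_le_one⟩
  obtain ⟨s, hs, hs0⟩ := intermediate_value_Icc' zero_le_one hcont.continuousOn this
  exact hne s hs hs0

/-- The determinant of `1 + A` is a fixed affine combination of the determinants of `1 + t • A`,
for any `finrank E + 1` values of `t`. -/
theorem exists_det_one_add_eq_sum (v : ℕ → ℝ) (hv : Injective v) :
    ∃ w : ℕ → ℝ, ∑ i ∈ Finset.range (finrank ℝ E + 1), w i = 1 ∧ ∀ A : E →L[ℝ] E,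
      (1 + A).det = ∑ i ∈ Finset.range (finrank ℝ E + 1), w i * (1 + v i • A).det := by
  set s := Finset.range (finrank ℝ E + 1) with hs
  refine ⟨fun i => (Lagrange.basis s v i).eval 1, ?_, fun A => ?_⟩
  · rw [← Polynomial.eval_finsetSum, Lagrange.sum_basis hv.injOn (by simp [hs]),
      Polynomial.eval_one]
  · let b := finBasis ℝ E
    let M := LinearMap.toMatrix b b A.toLinearMap
    let P : Polynomial ℝ := Matrix.det ((Polynomial.X : Polynomial ℝ) • M.map Polynomial.C
      + (1 : Matrix _ _ ℝ).map Polynomial.C)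
    have hP : ∀ t : ℝ, P.eval t = (1 + t • A).det := by
      intro t
      have h1 : (1 + t • A).det = Matrix.det (t • M + 1) := by
        rw [ContinuousLinearMap.det, ← LinearMap.det_toMatrix b]
        congr 1
        rw [ContinuousLinearMap.toLinearMap_add, map_add, add_comm]
        simp [M]
      rw [h1, ← Polynomial.coe_evalRingHom, RingHom.map_det]
      congr 1
      ext i j
      rcases eq_or_ne i j with rfl | hij
      · simp only [RingHom.mapMatrix_apply, Matrix.map_apply, Matrix.add_apply, Matrix.smul_apply,
          smul_eq_mul, Matrix.one_apply_eq, Polynomial.coe_evalRingHom, Polynomial.eval_add,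
          Polynomial.eval_mul, Polynomial.eval_X, Polynomial.eval_C]
      · simp only [RingHom.mapMatrix_apply, Matrix.map_apply, Matrix.add_apply, Matrix.smul_apply,
          smul_eq_mul, Matrix.one_apply_ne hij, Polynomial.coe_evalRingHom, Polynomial.eval_add,
          Polynomial.eval_mul, Polynomial.eval_X, Polynomial.eval_C]
    have hdeg : P.degree < s.card := by
      refine lt_of_le_of_lt (Polynomial.degree_le_of_natDegree_le
        (Polynomial.natDegree_det_X_add_C_le M 1)) ?_
      simp only [Fintype.card_fin, hs, Finset.card_range]
      exact_mod_cast Nat.lt_succ_self _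
    have h := congrArg (Polynomial.eval 1) (Lagrange.eq_interpolate hv.injOn hdeg)
    rw [hP, one_smul] at h
    rw [h, Lagrange.interpolate_apply, Polynomial.eval_finsetSum]
    refine Finset.sum_congr rfl fun i _ => ?_
    simp [hP, mul_comm]

theorem bijective_id_add_of_lipschitz {K : ℝ≥0} (hK : K < 1) {u : E → E}
    (hu : LipschitzWith K u) : Bijective fun x => x + u x := by
  have happ : ApproximatesLinearOn (fun x => x + u x)
      ((ContinuousLinearEquiv.refl ℝ E : E ≃L[ℝ] E) : E →L[ℝ] E) univ K := by
    rw [ApproximatesLinearOn.approximatesLinearOn_iff_lipschitzOnWith]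
    convert hu.lipschitzOnWith using 1
    ext x; simp
  have hc : Subsingleton E ∨ K < ‖((ContinuousLinearEquiv.refl ℝ E).symm : E →L[ℝ] E)‖₊⁻¹ := by
    rcases subsingleton_or_nontrivial E with h | h
    · exact Or.inl h
    · right
      have : ‖((ContinuousLinearEquiv.refl ℝ E).symm : E →L[ℝ] E)‖₊ = 1 := by
        ext; exact ContinuousLinearMap.norm_id
      rwa [this, inv_one]
  exact ⟨injOn_univ.1 (happ.injOn hc), happ.surjective hc⟩

variable [MeasurableSpace E] [BorelSpace E] (μ : Measure E) [μ.IsAddHaarMeasure]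

theorem LipschitzWith.addHaar_image_eq_zero {K : ℝ≥0} {f : E → E} (hf : LipschitzWith K f)
    {s : Set E} (hs : μ s = 0) : μ (f '' s) = 0 := by
  have hac := Measure.isAddLeftInvariant_eq_smul (μH[finrank ℝ E] : Measure E) μ
  have h0 : (μH[finrank ℝ E] : Measure E) s = 0 := by
    rw [hac]; simp [hs]
  have h1 : (μH[finrank ℝ E] : Measure E) (f '' s) = 0 := by
    refine le_antisymm ((hf.hausdorffMeasure_image_le (Nat.cast_nonneg _) s).trans ?_) zero_le
    simp [h0]
  rw [Measure.isAddLeftInvariant_eq_smul μ (μH[finrank ℝ E] : Measure E)]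
  simp [h1]

theorem lintegral_det_id_add_of_small {K : ℝ≥0} (hK : K < 1) {u : E → E}
    (hu : LipschitzWith K u) {s : Set E} (hs : MeasurableSet s)
    (h0 : ∀ x ∉ s, u x = 0) :
    ∫⁻ x in s, ENNReal.ofReal (1 + fderiv ℝ u x).det ∂μ = μ s := by
  set G : E → E := fun x => x + u x with hG
  have hbij : Bijective G := bijective_id_add_of_lipschitz hK hu
  have hGL : LipschitzWith (1 + K) G := LipschitzWith.id.add hu
  set T := {x | DifferentiableAt ℝ u x} with hT
  have hTm : MeasurableSet T := measurableSet_of_differentiableAt ℝ u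
  have hTn : μ Tᶜ = 0 := hu.ae_differentiableAt
  have himg : G '' s = s := by
    have hc : G '' sᶜ = sᶜ := by
      have : EqOn G id sᶜ := fun x hx => by simp [hG, h0 x hx]
      rw [this.image_eq, image_id]
    rw [image_compl_eq hbij] at hc
    exact compl_injective hc
  have hdet : ∀ x, 0 < (1 + fderiv ℝ u x).det := fun x =>
    det_one_add_pos_of_norm_lt_one ((norm_fderiv_le_of_lipschitz ℝ hu).trans_lt hK)
  have hae : (s ∩ T : Set E) =ᵐ[μ] s := by
    refine inter_ae_eq_left_of_ae_eq_univ ?_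
    rwa [ae_eq_univ]
  have hd : ∀ x ∈ s ∩ T, HasFDerivWithinAt G (1 + fderiv ℝ u x) (s ∩ T) x := fun x hx =>
    ((hasFDerivAt_id x).add hx.2.hasFDerivAt).hasFDerivWithinAt
  have hkey := lintegral_abs_det_fderiv_eq_addHaar_image μ (hs.inter hTm) hd hbij.1.injOn
  rw [setLIntegral_congr hae] at hkey
  simp only [abs_of_pos (hdet _)] at hkey
  rw [hkey]
  refine le_antisymm ((measure_mono (image_mono inter_subset_left)).trans_eq (by rw [himg])) ?_
  calc μ s = μ (G '' s) := by rw [himg]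
    _ ≤ μ (G '' (s ∩ T) ∪ G '' Tᶜ) := by
        rw [← image_union]
        refine measure_mono (image_mono fun x hx => ?_)
        by_cases h : x ∈ T
        · exact Or.inl ⟨hx, h⟩
        · exact Or.inr h
    _ ≤ μ (G '' (s ∩ T)) + μ (G '' Tᶜ) := measure_union_le _ _
    _ = μ (G '' (s ∩ T)) := by rw [hGL.addHaar_image_eq_zero μ hTn, add_zero]

/-- A compactly supported Lipschitz perturbation of the identity has average Jacobian one. -/
theorem integral_det_id_add {K : ℝ≥0} {u : E → E} (hu : LipschitzWith K u) {s : Set E}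
    (hs : MeasurableSet s) (hsf : μ s ≠ ∞) (h0 : ∀ x ∉ s, u x = 0) :
    ∫ x in s, (1 + fderiv ℝ u x).det ∂μ = μ.real s := by
  set v : ℕ → ℝ := fun i => ((K : ℝ) + 1 + i)⁻¹ with hv
  have hpos : ∀ i : ℕ, (0 : ℝ) < K + 1 + i := fun i => by positivity
  have hvinj : Injective v := by
    intro i j hij
    have := inv_injective hij
    exact_mod_cast (add_left_cancel this)
  have hsmall : ∀ i, IntegrableOn (fun x => (1 + v i • fderiv ℝ u x).det) s μ ∧
      ∫ x in s, (1 + v i • fderiv ℝ u x).det ∂μ = μ.real s := by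
    intro i
    have hvi : 0 ≤ v i := (inv_pos.2 (hpos i)).le
    have hL : LipschitzWith (‖v i‖₊ * K) (v i • u) := (lipschitzWith_smul (v i)).comp hu
    have hlt : ‖v i‖₊ * K < 1 := by
      rw [← NNReal.coe_lt_coe]
      push_cast
      rw [Real.norm_of_nonneg hvi, hv]
      simp only
      rw [inv_mul_lt_iff₀ (hpos i)]
      have : (0 : ℝ) ≤ i := Nat.cast_nonneg i
      linarith
    have hfd : ∀ x, fderiv ℝ (v i • u) x = v i • fderiv ℝ u x := fun x =>
      congrFun (fderiv_const_smul_field (𝕜 := ℝ) (v i) (f := u)) x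
    have h := lintegral_det_id_add_of_small μ hlt hL hs (fun x hx => by simp [h0 x hx])
    have hdet : ∀ x, 0 ≤ (1 + fderiv ℝ (v i • u) x).det := fun x =>
      (det_one_add_pos_of_norm_lt_one ((norm_fderiv_le_of_lipschitz ℝ hL).trans_lt hlt)).le
    have hmeas : Measurable fun x => (1 + fderiv ℝ (v i • u) x).det :=
      ContinuousLinearMap.continuous_det.measurable.comp
        ((measurable_fderiv ℝ _).const_add _)
    simp only [← hfd]
    refine ⟨⟨hmeas.aestronglyMeasurable, ?_⟩, ?_⟩
    · rw [hasFiniteIntegral_iff_ofReal (Eventually.of_forall hdet), h]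
      exact hsf.lt_top
    · rw [integral_eq_lintegral_of_nonneg_ae (Eventually.of_forall hdet)
        hmeas.aestronglyMeasurable, h, Measure.real]
  obtain ⟨w, hw1, hw⟩ := exists_det_one_add_eq_sum (E := E) v hvinj
  rw [integral_congr_ae (Eventually.of_forall fun x => hw (fderiv ℝ u x)),
    integral_finsetSum _ fun i _ => ((hsmall i).1.const_mul (w i))]
  simp only [integral_const_mul, (hsmall _).2]
  rw [← Finset.sum_mul, hw1, one_mul]

end Degree

section NoRetraction

variable {E : Type*} [NormedAddCommGroup E]

theorem LipschitzOnWith.indicator_closedBall [NormedSpace ℝ E] {K : ℝ≥0} {u : E → E} {r : ℝ}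
    (hu : LipschitzOnWith K u (closedBall 0 r)) (h0 : ∀ x, ‖x‖ = r → u x = 0) :
    LipschitzWith K ((closedBall 0 r).indicator u) := by
  have key : ∀ x ∈ closedBall (0 : E) r, ∀ y ∉ closedBall (0 : E) r,
      dist (u x) 0 ≤ K * dist x y := by
    intro x hx y hy
    rw [mem_closedBall_zero_iff] at hx hy
    obtain ⟨z, hz, hzr⟩ := (convex_segment x y).isPreconnected.intermediate_value
      (left_mem_segment ℝ x y) (right_mem_segment ℝ x y) continuous_norm.continuousOn
      ⟨hx, (not_le.1 hy).le⟩
    have hxz : dist x z ≤ dist x y := by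
      have := segment_subset_closedBall_left x y hz
      rwa [mem_closedBall, dist_comm] at this
    rw [← h0 z hzr]
    exact (hu.dist_le_mul x (mem_closedBall_zero_iff.2 hx) z
      (mem_closedBall_zero_iff.2 hzr.le)).trans (by gcongr)
  refine LipschitzWith.of_dist_le_mul fun x y => ?_
  by_cases hx : x ∈ closedBall (0 : E) r <;> by_cases hy : y ∈ closedBall (0 : E) r
  · simpa [hx, hy] using hu.dist_le_mul x hx y hy
  · rw [indicator_of_mem hx, indicator_of_notMem hy]
    exact key x hx y hy
  · rw [indicator_of_notMem hx, indicator_of_mem hy, dist_comm, dist_comm x y]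
    exact key y hy x hx
  · rw [indicator_of_notMem hx, indicator_of_notMem hy, dist_self]
    positivity

variable [InnerProductSpace ℝ E] [FiniteDimensional ℝ E]

theorem det_eq_zero_of_norm_eventually_const {H : E → E} {L : E →L[ℝ] E} {x : E} {r : ℝ}
    (hr : 0 < r) (hL : HasFDerivAt H L x) (hH : ∀ᶠ y in 𝓝 x, ‖H y‖ = r) : L.det = 0 := by
  by_contra hdet
  have h1 : HasFDerivAt (fun y => ‖H y‖ ^ 2) (0 : E →L[ℝ] ℝ) x := by
    refine (hasFDerivAt_const (r ^ 2) x).congr_of_eventuallyEq ?_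
    filter_upwards [hH] with y hy
    rw [hy]
  have h2 := h1.unique hL.norm_sq
  obtain ⟨v, hv⟩ := (L.toContinuousLinearEquivOfDetNeZero hdet).surjective (H x)
  rw [ContinuousLinearMap.toContinuousLinearEquivOfDetNeZero_apply] at hv
  have h3 := congrArg (fun T : E →L[ℝ] ℝ => T v) h2
  simp [hv] at h3
  have := hH.self_of_nhds
  rw [h3, norm_zero] at this
  exact hr.ne this

/-- There is no Lipschitz retraction of a closed ball onto its boundary sphere. -/
theorem no_lipschitz_retraction {K : ℝ≥0} {H : E → E} {r : ℝ} (hr : 0 < r)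
    (hH : LipschitzOnWith K H (closedBall 0 r)) (hid : ∀ x, ‖x‖ = r → H x = x)
    (hnorm : ∀ x ∈ closedBall 0 r, ‖H x‖ = r) : False := by
  borelize E
  let μ : Measure E := Measure.addHaar
  set u : E → E := (closedBall 0 r).indicator fun x => H x - x with hu
  have huL : LipschitzWith (K + 1) u :=
    (hH.sub LipschitzWith.id.lipschitzOnWith).indicator_closedBall
      fun x hx => by simp [hid x hx]
  have hu0 : ∀ x ∉ ball (0 : E) r, u x = 0 := by
    intro x hx
    by_cases hx' : x ∈ closedBall (0 : E) r
    · have : ‖x‖ = r := le_antisymm (mem_closedBall_zero_iff.1 hx')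
        (not_lt.1 fun h => hx (mem_ball_zero_iff.2 h))
      simp [hu, hid x this]
    · exact indicator_of_notMem hx' _
  have hint := integral_det_id_add μ huL measurableSet_ball measure_ball_lt_top.ne hu0
  have hzero : ∫ x in ball (0 : E) r, (1 + fderiv ℝ u x).det ∂μ = 0 := by
    refine setIntegral_eq_zero_of_ae_eq_zero ?_
    filter_upwards [huL.ae_differentiableAt (μ := μ)] with x hx hxr
    refine det_eq_zero_of_norm_eventually_const hr
      ((hasFDerivAt_id x).add hx.hasFDerivAt) ?_
    filter_upwards [isOpen_ball.mem_nhds hxr] with y hy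
    have hy' := ball_subset_closedBall hy
    simpa [hu, hy'] using hnorm y hy'
  rw [hzero] at hint
  exact (ENNReal.toReal_pos (measure_ball_pos μ 0 hr).ne' measure_ball_lt_top.ne).ne hint

/-- A Lipschitz map which is close to the identity on a ball covers a smaller ball. -/
theorem ball_subset_image_of_norm_sub_le {K : ℝ≥0} {g : E → E} (hg : LipschitzWith K g) {r : ℝ}
    (hr : 0 < r) (hclose : ∀ x ∈ closedBall 0 r, ‖g x - x‖ ≤ r / 4) :
    ball 0 (r / 4) ⊆ g '' closedBall 0 r := by
  intro y hy
  rw [mem_ball_zero_iff] at hy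
  by_contra hyg
  let χ : E → ℝ := fun x => min 1 (2 - 2 / r * ‖x‖)
  let p : E → E := fun x => x - g x + y
  let F : E → E := fun x => x - χ x • p x
  have hp : ∀ x ∈ closedBall (0 : E) r, ‖p x‖ ≤ r / 2 := fun x hx => by
    calc ‖p x‖ ≤ ‖x - g x‖ + ‖y‖ := norm_add_le _ _
      _ ≤ r / 4 + r / 4 := by
        rw [norm_sub_rev]; exact add_le_add (hclose x hx) hy.le
      _ = r / 2 := by ring
  have hF0 : ∀ x ∈ closedBall (0 : E) r, F x ≠ 0 := by
    intro x hx hFx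
    have hxr := mem_closedBall_zero_iff.1 hx
    have hxe : x = χ x • p x := sub_eq_zero.1 hFx
    have hχ0 : 0 ≤ χ x := by
      refine le_min zero_le_one ?_
      have : 2 / r * ‖x‖ ≤ 2 / r * r := by gcongr
      rw [div_mul_cancel₀ _ hr.ne'] at this
      linarith
    have hxn : ‖x‖ ≤ r / 2 := by
      rw [hxe, norm_smul, Real.norm_of_nonneg hχ0]
      exact (mul_le_of_le_one_left (norm_nonneg _) (min_le_left _ _)).trans (hp x hx)
    have hχ1 : χ x = 1 := by
      refine min_eq_left ?_
      have : 2 / r * ‖x‖ ≤ 2 / r * (r / 2) := by gcongr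
      have h2 : 2 / r * (r / 2) = 1 := by field_simp
      linarith
    rw [hχ1, one_smul] at hxe
    refine hyg ⟨x, hx, ?_⟩
    have : x = x - g x + y := hxe
    have h3 : g x - y = 0 := by
      calc g x - y = x - (x - g x + y) := by abel
        _ = 0 := by rw [← this, sub_self]
    exact sub_eq_zero.1 h3
  have hχL : LocallyLipschitz χ :=
    (LocallyLipschitz.const (2 : ℝ)).sub
      (((lipschitzWith_smul (2 / r)).comp lipschitzWith_one_norm).locallyLipschitz)
      |>.const_min 1
  have hpL : LocallyLipschitz p :=
    (LocallyLipschitz.id.sub hg.locallyLipschitz).add (LocallyLipschitz.const y)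
  have hsmul : LocallyLipschitz fun z : ℝ × E => z.1 • z.2 :=
    (contDiff_fst.smul contDiff_snd : ContDiff ℝ 1 fun z : ℝ × E => z.1 • z.2).locallyLipschitz
  have hFL : LocallyLipschitz F :=
    LocallyLipschitz.id.sub (hsmul.comp (hχL.prodMk hpL))
  let N : E → E := fun v => (r * ‖v‖⁻¹) • v
  have hNL : ∀ v : E, v ≠ 0 → ∃ C, ∃ t ∈ 𝓝 v, LipschitzOnWith C N t := fun v hv => by
    have : ContDiffAt ℝ 1 N v :=
      (contDiffAt_const.mul ((contDiffAt_norm ℝ hv).inv (norm_ne_zero_iff.2 hv))).smul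
        contDiffAt_id
    exact this.exists_lipschitzOnWith
  have hHL : LocallyLipschitzOn (closedBall 0 r) (N ∘ F) := by
    intro x hx
    obtain ⟨C, t, ht, hC⟩ := hNL (F x) (hF0 x hx)
    obtain ⟨C', t', ht', hC'⟩ := hFL x
    refine ⟨C * C', t' ∩ F ⁻¹' t, mem_nhdsWithin_of_mem_nhds
      (inter_mem ht' (hFL.continuous.continuousAt ht)), ?_⟩
    exact hC.comp (hC'.mono inter_subset_left) fun z hz => hz.2
  obtain ⟨C, hC⟩ := hHL.exists_lipschitzOnWith_of_compact (isCompact_closedBall 0 r)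
  refine no_lipschitz_retraction hr hC (fun x hx => ?_) fun x hx => ?_
  · have hχ : χ x = 0 := by
      have : 2 - 2 / r * ‖x‖ = 0 := by rw [hx]; field_simp; ring
      simp [χ, this]
    have : F x = x := by simp [F, hχ]
    simp [N, this, hx, hr.ne']
  · have := norm_ne_zero_iff.2 (hF0 x hx)
    simp [N, norm_smul, abs_of_pos hr, this]

/-- A Lipschitz map is open at points where its derivative is invertible. -/
theorem LipschitzWith.image_mem_nhds_of_det_ne_zero {K : ℝ≥0} {f : E → E}
    (hf : LipschitzWith K f) {A : E →L[ℝ] E} {x : E} (hA : HasFDerivAt f A x)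
    (hdet : A.det ≠ 0) {s : Set E} (hs : s ∈ 𝓝 x) : f '' s ∈ 𝓝 (f x) := by
  let e := A.toContinuousLinearEquivOfDetNeZero hdet
  let g : E → E := fun h => e.symm (f (x + h) - f x)
  have hgL : LipschitzWith (‖(e.symm : E →L[ℝ] E)‖₊ * (K + 0)) g :=
    (e.symm : E →L[ℝ] E).lipschitz.comp
      ((by simpa [comp_def] using hf.comp (isometry_add_left x).lipschitz :
        LipschitzWith K fun h => f (x + h)).sub
        (LipschitzWith.const (f x)))
  have hg0 : HasFDerivAt g (ContinuousLinearMap.id ℝ E) 0 := by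
    have h1 : HasFDerivAt f A (x + 0) := by rwa [add_zero]
    have h2 : HasFDerivAt (fun h => f (x + h)) A 0 :=
      (hasFDerivAt_comp_add_left x).2 h1
    refine ((e.symm : E →L[ℝ] E).hasFDerivAt.comp 0 (h2.sub_const (f x))).congr_fderiv ?_
    ext v
    exact e.symm_apply_apply v
  have hlo := (hg0.isLittleO).def (show (0 : ℝ) < 1 / 4 by norm_num)
  have hs' : ∀ᶠ h in 𝓝 (0 : E), x + h ∈ s :=
    (by fun_prop : Continuous fun h : E => x + h).continuousAt (by simpa using hs)
  obtain ⟨ε, hε, hball⟩ := Metric.eventually_nhds_iff_ball.1 (hlo.and hs')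
  have hr : 0 < ε / 2 := half_pos hε
  have hsub : closedBall (0 : E) (ε / 2) ⊆ ball 0 ε := closedBall_subset_ball (half_lt_self hε)
  have hcov := ball_subset_image_of_norm_sub_le hgL hr fun h hh => by
    have := (hball h (hsub hh)).1
    have h2 := mem_closedBall_zero_iff.1 hh
    have h3 : g 0 = 0 := by simp [g]
    rw [h3, sub_zero, sub_zero, ContinuousLinearMap.id_apply] at this
    linarith
  have hopen : IsOpen ((fun v => f x + e v) '' ball 0 (ε / 2 / 4)) := by
    have := (e.toHomeomorph.trans (Homeomorph.addLeft (f x))).isOpenMap _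
      (isOpen_ball (x := (0 : E)) (ε := ε / 2 / 4))
    exact this
  refine mem_of_superset (hopen.mem_nhds ⟨0, mem_ball_self (by positivity), by simp⟩) ?_
  rintro _ ⟨v, hv, rfl⟩
  obtain ⟨h, hh, rfl⟩ := hcov hv
  exact ⟨x + h, (hball h (hsub hh)).2, by simp [g]⟩

end NoRetraction

section Frontier

theorem measure_frontier_iUnion_eq_zero {ι α : Type*} [Finite ι] [TopologicalSpace α]
    [MeasurableSpace α] (μ : Measure α) {s : ι → Set α} (hs : ∀ i, μ (frontier (s i)) = 0) :
    μ (frontier (⋃ i, s i)) = 0 := by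
  refine measure_mono_null (t := ⋃ i, frontier (s i)) ?_ (measure_iUnion_null hs)
  rintro x ⟨hx, hxi⟩
  rw [closure_iUnion_of_finite] at hx
  obtain ⟨i, hi⟩ := mem_iUnion.1 hx
  exact mem_iUnion.2 ⟨i, hi, fun h => hxi (interior_mono (subset_iUnion s i) h)⟩

variable {E : Type*} [NormedAddCommGroup E] [InnerProductSpace ℝ E] [FiniteDimensional ℝ E]
  [MeasurableSpace E] [BorelSpace E] (μ : Measure E) [μ.IsAddHaarMeasure]

theorem LipschitzWith.addHaar_frontier_image_eq_zero {K : ℝ≥0} {f : E → E}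
    (hf : LipschitzWith K f) {s : Set E} (hs : Bornology.IsBounded s) (h0 : μ (frontier s) = 0) :
    μ (frontier (f '' s)) = 0 := by
  set N := {x | DifferentiableAt ℝ f x}ᶜ with hN
  set Z := {x | DifferentiableAt ℝ f x ∧ (fderiv ℝ f x).det = 0} with hZ
  have hNn : μ (f '' N) = 0 := hf.addHaar_image_eq_zero μ hf.ae_differentiableAt
  have hZn : μ (f '' Z) = 0 := addHaar_image_eq_zero_of_det_fderivWithin_eq_zero μ
    (fun x hx => hx.1.hasFDerivAt.hasFDerivWithinAt) fun x hx => hx.2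
  refine measure_mono_null (t := f '' frontier s ∪ (f '' N ∪ f '' Z)) ?_
    (measure_union_null (hf.addHaar_image_eq_zero μ h0) (measure_union_null hNn hZn))
  intro y hy
  have hcl : closure (f '' s) ⊆ f '' closure s :=
    closure_minimal (image_mono subset_closure)
      (hs.isCompact_closure.image hf.continuous).isClosed
  obtain ⟨x, hx, rfl⟩ := hcl hy.1
  by_cases hxi : x ∈ interior s
  · right
    by_cases hd : DifferentiableAt ℝ f x
    · right
      refine ⟨x, ⟨hd, ?_⟩, rfl⟩
      by_contra hdet
      exact hy.2 (mem_interior_iff_mem_nhds.2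
        (hf.image_mem_nhds_of_det_ne_zero hd.hasFDerivAt hdet
          (mem_interior_iff_mem_nhds.1 hxi)))
    · exact Or.inl ⟨x, hd, rfl⟩
  · exact Or.inl ⟨x, ⟨hx, hxi⟩, rfl⟩

end Frontier

section Iteration

variable {d k : ℕ} (f : Fin k → EuclideanSpace ℝ (Fin d) → EuclideanSpace ℝ (Fin d))

theorem volume_PhiMap_eq_zero {r : Fin k → ℝ≥0} (hf : ∀ i, LipschitzWith (r i) (f i))
    {S : Set (EuclideanSpace ℝ (Fin d))} (hS : volume S = 0) : volume (PhiMap f S) = 0 :=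
  measure_iUnion_null fun i => (hf i).addHaar_image_eq_zero volume hS

/-- The iterates of `X ↦ D \ Φ(X)`, starting from `Y`. -/
def dissectionSeq (D Y : Set (EuclideanSpace ℝ (Fin d))) : ℕ → Set (EuclideanSpace ℝ (Fin d))
  | 0 => Y
  | n + 1 => D \ PhiMap f (dissectionSeq D Y n)

/-- The set of points belonging to all but finitely many iterates. -/
def dissectionLim (D Y : Set (EuclideanSpace ℝ (Fin d))) : Set (EuclideanSpace ℝ (Fin d)) :=
  {x | ∀ᶠ n in atTop, x ∈ dissectionSeq f D Y n}

variable {f} {D Y E : Set (EuclideanSpace ℝ (Fin d))}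

theorem dissectionSeq_subset (hYD : Y ⊆ D) : ∀ n, dissectionSeq f D Y n ⊆ D
  | 0 => hYD
  | _ + 1 => sdiff_subset

theorem dissectionLim_subset (hYD : Y ⊆ D) : dissectionLim f D Y ⊆ D := fun _ hx =>
  let ⟨n, hn⟩ := Eventually.exists hx
  dissectionSeq_subset hYD n hn

theorem volume_frontier_dissectionSeq {r : Fin k → ℝ≥0} (hf : ∀ i, LipschitzWith (r i) (f i))
    (hD : Bornology.IsBounded D) (hfr : volume (frontier D) = 0) (hYD : Y ⊆ D)
    (hYfr : volume (frontier Y) = 0) (n : ℕ) :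
    volume (frontier (dissectionSeq f D Y n)) = 0 := by
  induction n with
  | zero => exact hYfr
  | succ n ih =>
    have hΦ : volume (frontier (PhiMap f (dissectionSeq f D Y n))) = 0 :=
      measure_frontier_iUnion_eq_zero volume fun i =>
        (hf i).addHaar_frontier_image_eq_zero volume
          (hD.subset (dissectionSeq_subset hYD n)) ih
    refine measure_mono_null (t := frontier D ∪ frontier (PhiMap f (dissectionSeq f D Y n))) ?_
      (measure_union_null hfr hΦ)
    rw [dissectionSeq, sdiff_eq, ← frontier_compl (PhiMap f _)]
    exact (frontier_inter_subset _ _).trans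
      (union_subset_union inter_subset_left inter_subset_right)

/-- Consecutive iterates differ only in a small neighbourhood of an invariant set. -/
theorem infDist_le_of_mem_symmDiff {c : ℝ≥0} (hf : ∀ i, LipschitzWith c (f i))
    (hE : E.Nonempty) (hEmaps : ∀ i, MapsTo (f i) E E) {M : ℝ}
    (hM : ∀ x ∈ D, infDist x E ≤ M) (hYD : Y ⊆ D) (n : ℕ) :
    ∀ x, ¬(x ∈ dissectionSeq f D Y n ↔ x ∈ dissectionSeq f D Y (n + 1)) →
      infDist x E ≤ c ^ n * M := by
  induction n with
  | zero =>
    intro x hx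
    rw [pow_zero, one_mul]
    refine hM x ?_
    by_contra hxD
    exact hx ⟨fun h => absurd (dissectionSeq_subset hYD _ h) hxD,
      fun h => absurd (dissectionSeq_subset hYD _ h) hxD⟩
  | succ n ih =>
    intro x hx
    have hex : ∃ i, ∃ z, f i z = x ∧
        ¬(z ∈ dissectionSeq f D Y n ↔ z ∈ dissectionSeq f D Y (n + 1)) := by
      by_contra! hno
      refine hx (and_congr_right fun _ => not_congr ?_)
      simp only [PhiMap, mem_iUnion, mem_image]
      exact exists_congr fun i => exists_congr fun z =>
        ⟨fun h => ⟨(hno i z h.2).1 h.1, h.2⟩, fun h => ⟨(hno i z h.2).2 h.1, h.2⟩⟩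
    obtain ⟨i, z, rfl, hz⟩ := hex
    have hcontr : infDist (f i z) E ≤ c * infDist z E := by
      by_contra! hlt
      have hc : (0 : ℝ) < c := by
        rcases c.coe_nonneg.eq_or_lt with h | h
        · obtain ⟨e, he⟩ := hE
          have h1 := (infDist_le_dist_of_mem (hEmaps i he)).trans ((hf i).dist_le_mul z e)
          rw [← h, zero_mul] at h1 hlt
          exact absurd hlt h1.not_gt
        · exact h
      rw [← lt_div_iff₀' hc] at hlt
      obtain ⟨e, he, hze⟩ := (infDist_lt_iff hE).1 hlt
      rw [lt_div_iff₀' hc] at hze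
      exact absurd ((infDist_le_dist_of_mem (hEmaps i he)).trans ((hf i).dist_le_mul z e))
        hze.not_ge
    calc infDist (f i z) E ≤ c * infDist z E := hcontr
      _ ≤ c * (c ^ n * M) := by gcongr; exact ih z hz
      _ = c ^ (n + 1) * M := by ring

/-- Away from the attractor, the iterates are locally eventually constant. -/
theorem exists_isOpen_dissectionSeq_eq_lim {c : ℝ≥0} (hc : c < 1)
    (hf : ∀ i, LipschitzWith c (f i)) (hD : Bornology.IsBounded D) (hE : E.Nonempty)
    (hEc : IsCompact E) (hEmaps : ∀ i, MapsTo (f i) E E) (hYD : Y ⊆ D)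
    {x : EuclideanSpace ℝ (Fin d)} (hx : x ∉ E) :
    ∃ V, IsOpen V ∧ x ∈ V ∧ ∃ N, ∀ n ≥ N, ∀ y ∈ V,
      (y ∈ dissectionSeq f D Y n ↔ y ∈ dissectionLim f D Y) := by
  obtain ⟨e, he⟩ := hE
  obtain ⟨M, hM⟩ := hD.subset_closedBall e
  have hM' : ∀ x ∈ D, infDist x E ≤ M := fun x hx =>
    (infDist_le_dist_of_mem he).trans (hM hx)
  have hpos : 0 < infDist x E := (hEc.isClosed.notMem_iff_infDist_pos ⟨e, he⟩).1 hx
  have hlim : Tendsto (fun n : ℕ => (c : ℝ) ^ n * M) atTop (𝓝 0) := by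
    simpa using (tendsto_pow_atTop_nhds_zero_of_lt_one c.coe_nonneg
      (by exact_mod_cast hc)).mul_const M
  obtain ⟨N, hN⟩ := eventually_atTop.1 (hlim.eventually (gt_mem_nhds (half_pos hpos)))
  refine ⟨{y | infDist x E / 2 < infDist y E},
    isOpen_lt continuous_const (continuous_infDist_pt E), half_lt_self hpos, N, ?_⟩
  have hconst : ∀ n ≥ N, ∀ y, infDist x E / 2 < infDist y E →
      (y ∈ dissectionSeq f D Y n ↔ y ∈ dissectionSeq f D Y N) := by
    intro n hn y hy
    induction n, hn using Nat.le_induction with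
    | base => rfl
    | succ n hn ih =>
      refine Iff.trans (Iff.symm ?_) ih
      by_contra hne
      have := infDist_le_of_mem_symmDiff hf ⟨e, he⟩ hEmaps hM' hYD n y hne
      exact absurd (this.trans_lt (hN n hn)) hy.not_gt
  intro n hn y hy
  rw [hconst n hn y hy]
  constructor
  · intro h
    exact eventually_atTop.2 ⟨N, fun m hm => (hconst m hm y hy).2 h⟩
  · intro h
    obtain ⟨m, hm, hmN⟩ := (Eventually.and h (eventually_ge_atTop N)).exists
    exact (hconst m hmN y hy).1 hm

end Iteration

/-- General dissection theorem: if `Y ⊆ D` satisfies conditions (1)–(3), then `D`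
admits a dissection with respect to `{f₁,…,f_k}`. -/
theorem general_dissection {d k : ℕ}
    (D : Set (EuclideanSpace ℝ (Fin d))) (hDc : IsCompact D)
    (hDcl : D = closure (interior D)) (hfr : volume (frontier D) = 0)
    (f : Fin k → EuclideanSpace ℝ (Fin d) → EuclideanSpace ℝ (Fin d))
    (r : Fin k → NNReal) (hf : ∀ i, ContractingWith (r i) (f i))
    (hinj : ∀ i, Function.Injective (f i))
    (E : Set (EuclideanSpace ℝ (Fin d))) (hE : E.Nonempty) (hEc : IsCompact E)
    (hEfix : E = ⋃ i, f i '' E) (hEvol : volume E = 0)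
    (Y : Set (EuclideanSpace ℝ (Fin d))) (hYD : Y ⊆ D)
    -- (1)
    (hYcl : Y = closure (interior Y)) (hYfr : volume (frontier Y) = 0)
    -- (2)
    (h2sub : ∀ i, f i '' Y ⊆ D)
    (h2Y : ∀ i, volume (Y ∩ f i '' Y) = 0)
    (h2ij : ∀ i j, i ≠ j → volume (f i '' Y ∩ f j '' Y) = 0)
    -- (3)
    (h3sub : ∀ i, f i '' (D \ PhiMap f Y) ⊆ D)
    (h3Y : ∀ i, volume (Y ∩ f i '' (D \ PhiMap f Y)) = 0)
    (h3ij : ∀ i j, i ≠ j →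
      volume (f i '' (D \ PhiMap f Y) ∩ f j '' (D \ PhiMap f Y)) = 0) :
    ∃ X : Set (EuclideanSpace ℝ (Fin d)), IsCompact X ∧ X = closure (interior X) ∧
      D = X ∪ PhiMap f X ∧
      (∀ i, volume (X ∩ f i '' X) = 0) ∧
      (∀ i j, i ≠ j → volume (f i '' X ∩ f j '' X) = 0) := by
  have hL : ∀ i, LipschitzWith (r i) (f i) := fun i => (hf i).2
  obtain ⟨c, hc, hrc⟩ : ∃ c : ℝ≥0, c < 1 ∧ ∀ i, r i ≤ c :=
    ⟨Finset.univ.sup r, (Finset.sup_lt_iff zero_lt_one).2 fun i _ => (hf i).1,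
      fun i => Finset.le_sup (Finset.mem_univ i)⟩
  have hLc : ∀ i, LipschitzWith c (f i) := fun i => (hL i).weaken (hrc i)
  have hEmaps : ∀ i, MapsTo (f i) E E := fun i x hx => by
    rw [hEfix]; exact mem_iUnion.2 ⟨i, x, hx, rfl⟩
  have hloc := fun x hx => exists_isOpen_dissectionSeq_eq_lim (x := x) hc hLc hDc.isBounded hE hEc
    hEmaps hYD hx
  set Z := D \ PhiMap f Y with hZ
  set L := dissectionLim f D Y with hLdef
  have hLD : L ⊆ D := dissectionLim_subset hYD
  have hLfr : volume (frontier L) = 0 := by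
    refine measure_mono_null (t := E ∪ ⋃ n, frontier (dissectionSeq f D Y n)) ?_
      (measure_union_null hEvol (measure_iUnion_null
        (volume_frontier_dissectionSeq hL hDc.isBounded hfr hYD hYfr)))
    intro x hx
    by_cases hxE : x ∈ E
    · exact Or.inl hxE
    right
    obtain ⟨V, hV, hxV, N, hN⟩ := hloc x hxE
    refine mem_iUnion.2 ⟨N, ?_⟩
    rw [frontier, Set.mem_sdiff, mem_closure_iff_nhds, mem_interior_iff_mem_nhds] at hx ⊢
    have hVx := hV.mem_nhds hxV
    refine ⟨fun t ht => ?_, fun h => hx.2 ?_⟩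
    · obtain ⟨y, ⟨hyt, hyV⟩, hyL⟩ := hx.1 _ (inter_mem ht hVx)
      exact ⟨y, hyt, (hN N le_rfl y hyV).2 hyL⟩
    · filter_upwards [h, hVx] with y hy hyV
      exact (hN N le_rfl y hyV).1 hy
  have hLfix : ∀ x ∈ D, x ∉ E → (x ∈ L ↔ x ∉ PhiMap f L) := by
    intro x hxD hxE
    constructor
    · intro hxL hxΦ
      obtain ⟨i, z, hz, rfl⟩ := mem_iUnion.1 hxΦ
      have hxL' := (tendsto_add_atTop_nat 1).eventually hxL
      obtain ⟨n, hn, hn'⟩ := (Eventually.and hz hxL').exists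
      exact hn'.2 (mem_iUnion.2 ⟨i, z, hn, rfl⟩)
    · intro hxΦ
      have hi : ∀ i, ∀ᶠ n in atTop, x ∉ f i '' dissectionSeq f D Y n := by
        intro i
        by_cases hxi : x ∈ range (f i)
        · obtain ⟨z, rfl⟩ := hxi
          have hzE : z ∉ E := fun h => hxE (hEmaps i h)
          have hzL : z ∉ L := fun h => hxΦ (mem_iUnion.2 ⟨i, z, h, rfl⟩)
          obtain ⟨V, -, hzV, N, hN⟩ := hloc z hzE
          filter_upwards [eventually_ge_atTop N] with n hn
          rw [(hinj i).mem_set_image, hN n hn z hzV]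
          exact hzL
        · exact Eventually.of_forall fun n h => hxi (image_subset_range _ _ h)
      obtain ⟨N, hN⟩ := eventually_atTop.1 (eventually_all.2 hi)
      refine eventually_atTop.2 ⟨N + 1, fun n hn => ?_⟩
      obtain ⟨m, rfl⟩ : ∃ m, n = m + 1 := ⟨n - 1, by omega⟩
      refine ⟨hxD, fun h => ?_⟩
      obtain ⟨i, hi⟩ := mem_iUnion.1 h
      exact hN m (by omega) i hi
  have hdiffΦ : ∀ S T : Set (EuclideanSpace ℝ (Fin d)), volume (S \ T) = 0 →
      volume (PhiMap f S \ PhiMap f T) = 0 := fun S T h => by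
    refine measure_mono_null ?_ (volume_PhiMap_eq_zero f hL h)
    rintro _ ⟨hx, hxT⟩
    obtain ⟨i, z, hz, rfl⟩ := mem_iUnion.1 hx
    exact mem_iUnion.2 ⟨i, z, ⟨hz, fun h => hxT (mem_iUnion.2 ⟨i, z, h, rfl⟩)⟩, rfl⟩
  have hYinter : ∀ S : Set (EuclideanSpace ℝ (Fin d)),
      (∀ i, volume (Y ∩ f i '' S) = 0) → volume (Y ∩ PhiMap f S) = 0 := fun S h => by
    rw [PhiMap, inter_iUnion]
    exact measure_iUnion_null h
  have hsand : ∀ n, volume (Y \ dissectionSeq f D Y n) = 0 ∧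
      volume (dissectionSeq f D Y n \ Z) = 0 := by
    intro n
    induction n with
    | zero =>
      refine ⟨by simp [dissectionSeq], measure_mono_null ?_ (hYinter Y h2Y)⟩
      rintro x ⟨hx, hxZ⟩
      exact ⟨hx, by_contra fun h => hxZ ⟨hYD hx, h⟩⟩
    | succ n ih =>
      constructor
      · refine measure_mono_null ?_ (measure_union_null (hYinter Z h3Y) (hdiffΦ _ _ ih.2))
        rintro x ⟨hx, hxn⟩
        have hxΦ : x ∈ PhiMap f (dissectionSeq f D Y n) := by_contra fun h => hxn ⟨hYD hx, h⟩
        by_cases h : x ∈ PhiMap f Z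
        · exact Or.inl ⟨hx, h⟩
        · exact Or.inr ⟨hxΦ, h⟩
      · refine measure_mono_null ?_ (hdiffΦ _ _ ih.1)
        rintro x ⟨hx, hxZ⟩
        exact ⟨by_contra fun h => hxZ ⟨hx.1, h⟩, hx.2⟩
  have hLZ : volume (L \ Z) = 0 := by
    refine measure_mono_null (t := ⋃ n, dissectionSeq f D Y n \ Z) ?_
      (measure_iUnion_null fun n => (hsand n).2)
    rintro x ⟨hx, hxZ⟩
    obtain ⟨n, hn⟩ := Eventually.exists hx
    exact mem_iUnion.2 ⟨n, hn, hxZ⟩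
  set X := closure (interior L) with hX
  have hXD : X ⊆ D := closure_minimal (interior_subset.trans hLD) hDc.isClosed
  have hXc : IsCompact X := hDc.of_isClosed_subset isClosed_closure hXD
  have hXreg : X = closure (interior X) := (closure_interior_idem).symm
  have hXL : volume (X \ L) = 0 := measure_mono_null (t := frontier L)
    (fun x hx => ⟨closure_mono interior_subset hx.1, fun h => hx.2 (interior_subset h)⟩) hLfr
  have hLX : volume (L \ X) = 0 := measure_mono_null (t := frontier L)
    (fun x hx => ⟨subset_closure hx.1, fun h => hx.2 (subset_closure h)⟩) hLfr
  have hXZ : volume (X \ Z) = 0 := measure_mono_null (t := X \ L ∪ L \ Z)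
    (fun x hx => (em (x ∈ L)).elim (fun h => Or.inr ⟨h, hx.2⟩) fun h => Or.inl ⟨hx.1, h⟩)
    (measure_union_null hXL hLZ)
  have hdense : ∀ S T : Set (EuclideanSpace ℝ (Fin d)), IsOpen S → IsClosed T →
      volume (S \ T) = 0 → closure S ⊆ T := fun S T hS hT h =>
    closure_minimal (sdiff_eq_empty.1 ((hS.sdiff hT).eq_empty_of_measure_zero h)) hT
  have hXZcl : X ⊆ closure Z := by
    rw [hXreg]
    exact hdense _ _ isOpen_interior isClosed_closure
      (measure_mono_null (sdiff_subset_sdiff interior_subset subset_closure) hXZ)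
  have hΦXD : PhiMap f X ⊆ D := iUnion_subset fun i =>
    (image_mono hXZcl).trans ((image_closure_subset_closure_image (hL i).continuous).trans
      (closure_minimal (h3sub i) hDc.isClosed))
  have hΦXc : IsClosed (PhiMap f X) :=
    isClosed_iUnion_of_finite fun i => (hXc.image (hL i).continuous).isClosed
  refine ⟨X, hXc, hXreg, Subset.antisymm ?_ (union_subset hXD hΦXD), fun i => ?_,
    fun i j hij => ?_⟩
  · conv_lhs => rw [hDcl]
    refine hdense _ _ isOpen_interior (isClosed_closure.union hΦXc) (measure_mono_null ?_
      (measure_union_null hEvol (measure_union_null hLX (hdiffΦ _ _ hLX))))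
    rintro x ⟨hxD, hxX⟩
    by_cases hxE : x ∈ E
    · exact Or.inl hxE
    right
    by_cases hxL : x ∈ L
    · exact Or.inl ⟨hxL, fun h => hxX (Or.inl h)⟩
    · right
      exact ⟨by_contra fun h => hxL ((hLfix x (interior_subset hxD) hxE).2 h),
        fun h => hxX (Or.inr h)⟩
  · refine measure_mono_null ?_
      (measure_union_null hEvol (measure_union_null hXL (hdiffΦ _ _ hXL)))
    rintro x ⟨hxX, hxi⟩
    by_cases hxE : x ∈ E
    · exact Or.inl hxE
    right
    by_cases hxL : x ∈ L
    · right
      exact ⟨mem_iUnion.2 ⟨i, hxi⟩, (hLfix x (hXD hxX) hxE).1 hxL⟩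
    · exact Or.inl ⟨hxX, hxL⟩
  · have him : ∀ i, volume (f i '' (X \ Z)) = 0 := fun i =>
      (hL i).addHaar_image_eq_zero volume hXZ
    refine measure_mono_null ?_
      (measure_union_null (h3ij i j hij) (measure_union_null (him i) (him j)))
    rintro _ ⟨⟨x, hx, rfl⟩, y, hy, hxy⟩
    by_cases hxZ : x ∈ Z
    · by_cases hyZ : y ∈ Z
      · exact Or.inl ⟨⟨x, hxZ, rfl⟩, y, hyZ, hxy⟩
      · exact Or.inr (Or.inr ⟨y, ⟨hy, hyZ⟩, hxy⟩)
    · exact Or.inr (Or.inl ⟨x, ⟨hx, hxZ⟩, rfl⟩)
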